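/- Let Ω ⊂ ℝⁿ be a bounded QH-visibility domain. Then every quasihyperbolic geodesic ray γ : [0, ∞) → Ω lands at a point of the Euclidean boundary, i.e., lim_{t→∞} γ(t) exists in ∂Ω with respect to the Euclidean metric. Moreover, if γ and σ are two quasihyperbolic geodesic rays with γ(0) = σ(0) = x_0 that are equivalent (i.e., sup_{t≥0} k_Ω(γ(t), σ(t)) < ∞), then γ and σ land at the same boundary point. -/

import Mathlib

open Metric Set Filter Topology MeasureTheory
open scoped NNReal ENNReal

noncomputable section

variable {E : Type*} [NormedAddCommGroup E] [NormedSpace ℝ E]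

/-- The quasihyperbolic length of a path `γ : [a, b] → Ω`, i.e. `∫ ‖γ'(t)‖ / δ_Ω(γ t) dt`. -/
def qhLength (Ω : Set E) (γ : ℝ → E) (a b : ℝ) : ℝ :=
  ∫ t in a..b, ‖deriv γ t‖ / infDist (γ t) Ωᶜ

/-- Admissible (Lipschitz, i.e. rectifiable) paths joining `x` to `y` inside `Ω`. -/
def qhAdmissible (Ω : Set E) (x y : E) (γ : ℝ → E) (a b : ℝ) : Prop :=
  a ≤ b ∧ γ a = x ∧ γ b = y ∧ (∀ t ∈ Icc a b, γ t ∈ Ω) ∧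
    ∃ K : ℝ≥0, LipschitzOnWith K γ (Icc a b)

/-- The quasihyperbolic distance `k_Ω` on a domain `Ω`. -/
def qhDist (Ω : Set E) (x y : E) : ℝ :=
  sInf { L : ℝ | ∃ γ a b, qhAdmissible Ω x y γ a b ∧ L = qhLength Ω γ a b }

/-- `γ` is a (unit-speed) quasihyperbolic geodesic on the parameter set `s`. -/
def IsQHGeodesicOn (Ω : Set E) (γ : ℝ → E) (s : Set ℝ) : Prop :=
  (∀ t ∈ s, γ t ∈ Ω) ∧ ∀ a ∈ s, ∀ b ∈ s, qhDist Ω (γ a) (γ b) = |a - b|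

/-- `Ω` is a QH-visibility domain: any two distinct Euclidean boundary points have
neighbourhoods with disjoint closures together with a compact subset of `Ω` which is met by
every quasihyperbolic geodesic joining the two neighbourhoods. -/
def QHVisibilityDomain (Ω : Set E) : Prop :=
  ∀ p ∈ frontier Ω, ∀ q ∈ frontier Ω, p ≠ q →
    ∃ U V : Set E, IsOpen U ∧ IsOpen V ∧ p ∈ U ∧ q ∈ V ∧
      closure U ∩ closure V = ∅ ∧
      ∃ K : Set E, IsCompact K ∧ K ⊆ Ω ∧
        ∀ (γ : ℝ → E) (T : ℝ), 0 ≤ T → IsQHGeodesicOn Ω γ (Icc 0 T) →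
          γ 0 ∈ U → γ T ∈ V → ∃ t ∈ Icc 0 T, γ t ∈ K

section Paths

variable {F : Type*} [NormedAddCommGroup F] {Ω : Set F} {x y z : F}

theorem qhAdmissible.symm {γ : ℝ → F} {a b : ℝ} (h : qhAdmissible Ω x y γ a b) :
    qhAdmissible Ω y x (fun t => γ (-t)) (-b) (-a) := by
  obtain ⟨hab, ha, hb, hΩ, K, hK⟩ := h
  have hmem : ∀ t ∈ Icc (-b) (-a), -t ∈ Icc a b := fun t ht => by
    simp only [mem_Icc] at ht ⊢; constructor <;> linarith
  refine ⟨by linarith, by simpa, by simpa, fun t ht => hΩ _ (hmem t ht), K, ?_⟩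
  refine LipschitzOnWith.of_dist_le_mul fun s hs t ht => ?_
  simpa [dist_neg_neg] using hK.dist_le_mul _ (hmem s hs) _ (hmem t ht)

/-- Concatenation of admissible paths. -/
theorem qhAdmissible.trans {γ σ : ℝ → F} {a b c d : ℝ} (h : qhAdmissible Ω x y γ a b)
    (h' : qhAdmissible Ω y z σ c d) :
    qhAdmissible Ω x z (fun t => γ (min t b) + σ (c + max (t - b) 0) - y) a (b + (d - c)) := by
  obtain ⟨hab, ha, hb, hΩ, K, hK⟩ := h
  obtain ⟨hcd, hc, hd, hΩ', K', hK'⟩ := h'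
  have hmem : ∀ t ∈ Icc a (b + (d - c)), min t b ∈ Icc a b := fun t ht =>
    ⟨le_min ht.1 hab, min_le_right _ _⟩
  have hmem' : ∀ t ∈ Icc a (b + (d - c)), c + max (t - b) 0 ∈ Icc c d := fun t ht =>
    ⟨by linarith [le_max_right (t - b) 0],
      by linarith [max_le (show t - b ≤ d - c by linarith [ht.2]) (sub_nonneg.2 hcd)]⟩
  refine ⟨by linarith, by simp [hab, ha, hc], ?_, fun t ht => ?_, K + K', ?_⟩
  · simp [hcd, hb, hd]
  · rcases le_total t b with htb | htb
    · simpa [htb, hc] using hΩ t ⟨ht.1, htb⟩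
    · have := hΩ' _ (hmem' t ht)
      rw [max_eq_left (by linarith)] at this
      simpa [htb, hb] using this
  · refine LipschitzOnWith.of_dist_le_mul fun s hs t ht => ?_
    have h₁ := hK.dist_le_mul _ (hmem s hs) _ (hmem t ht)
    have h₂ := hK'.dist_le_mul _ (hmem' s hs) _ (hmem' t ht)
    have h₃ : dist (min s b) (min t b) ≤ dist s t := by
      simpa [Real.dist_eq] using abs_min_sub_min_le_max s b t b
    have h₄ : dist (c + max (s - b) 0) (c + max (t - b) 0) ≤ dist s t := by
      simpa [Real.dist_eq] using abs_max_sub_max_le_max (s - b) 0 (t - b) 0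
    have h₅ := mul_le_mul_of_nonneg_left h₃ K.2
    have h₆ := mul_le_mul_of_nonneg_left h₄ K'.2
    have h₇ := dist_add_add_le (γ (min s b)) (σ (c + max (s - b) 0)) (γ (min t b))
      (σ (c + max (t - b) 0))
    rw [dist_sub_right]
    push_cast
    simp only [NNReal.val_eq_coe] at h₅ h₆
    linarith

variable [NormedSpace ℝ F]

theorem qhLength_nonneg (γ : ℝ → F) {a b : ℝ} (hab : a ≤ b) : 0 ≤ qhLength Ω γ a b :=
  intervalIntegral.integral_nonneg hab fun _ _ => div_nonneg (norm_nonneg _) infDist_nonneg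

/-- The quasihyperbolic distance is at most the length of any admissible path. -/
theorem qhDist_le_qhLength {γ : ℝ → F} {a b : ℝ} (h : qhAdmissible Ω x y γ a b) :
    qhDist Ω x y ≤ qhLength Ω γ a b :=
  csInf_le ⟨0, by rintro _ ⟨γ, a, b, h, rfl⟩; exact qhLength_nonneg γ h.1⟩ ⟨γ, a, b, h, rfl⟩

theorem exists_qhAdmissible_of_qhDist_ne_zero (h : qhDist Ω x y ≠ 0) :
    ∃ γ a b, qhAdmissible Ω x y γ a b := by
  by_contra! hne
  refine h ?_
  simp [qhDist, hne]

theorem exists_qhAdmissible_qhLength_lt {C : ℝ} (h : ∃ γ a b, qhAdmissible Ω x y γ a b)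
    (hC : qhDist Ω x y < C) : ∃ γ a b, qhAdmissible Ω x y γ a b ∧ qhLength Ω γ a b < C := by
  obtain ⟨γ, a, b, hγ⟩ := h
  obtain ⟨_, ⟨γ, a, b, hγ, rfl⟩, hlt⟩ := exists_lt_of_csInf_lt
    (s := {L | ∃ γ a b, qhAdmissible Ω x y γ a b ∧ L = qhLength Ω γ a b}) ⟨_, γ, a, b, hγ, rfl⟩ hC
  exact ⟨γ, a, b, hγ, hlt⟩

/-- Two points of a ball of radius `r` whose double lies in `Ω` are at quasihyperbolic distance
at most `2`. -/
theorem qhDist_le_two_of_mem_ball {r : ℝ} (hr : 0 < r) (hball : ball z (2 * r) ⊆ Ω)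
    (hx : x ∈ ball z r) (hy : y ∈ ball z r) : qhDist Ω x y ≤ 2 := by
  have hmem : ∀ t ∈ Icc (0 : ℝ) 1, AffineMap.lineMap x y t ∈ ball z r := fun t ht =>
    (convex_ball z r).lineMap_mem hx hy ht
  have hadm : qhAdmissible Ω x y (AffineMap.lineMap x y) 0 1 := by
    refine ⟨zero_le_one, by simp, by simp, fun t ht => hball ?_, _,
      (lipschitzWith_lineMap x y).lipschitzOnWith⟩
    exact ball_subset_ball (by linarith) (hmem t ht)
  have hxy : ‖y - x‖ ≤ 2 * r := by
    rw [← dist_eq_norm]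
    linarith [dist_triangle_right y x z, mem_ball.1 hx, mem_ball.1 hy]
  refine (qhDist_le_qhLength hadm).trans ?_
  have hbound : ∀ t ∈ uIoc (0 : ℝ) 1, ‖‖deriv (AffineMap.lineMap x y : ℝ → F) t‖ /
      infDist (AffineMap.lineMap x y t) Ωᶜ‖ ≤ 2 := by
    intro t ht
    rw [uIoc_of_le zero_le_one] at ht
    rw [Real.norm_of_nonneg (div_nonneg (norm_nonneg _) infDist_nonneg),
      AffineMap.hasDerivAt_lineMap.deriv]
    rcases Ωᶜ.eq_empty_or_nonempty with he | hne
    · simp [he]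
    · have hd : r ≤ infDist (AffineMap.lineMap x y t : F) Ωᶜ := by
        refine (le_infDist hne).2 fun w hw => ?_
        have h₁ : 2 * r ≤ dist w z := not_lt.1 fun h => hw (hball h)
        have h₂ := mem_ball.1 (hmem t ⟨ht.1.le, ht.2⟩)
        have h₃ := dist_triangle_left w z (AffineMap.lineMap x y t)
        linarith
      rw [div_le_iff₀ (hr.trans_le hd)]
      linarith
  simpa [qhLength] using (Real.le_norm_self _).trans
    (intervalIntegral.norm_integral_le_of_norm_le_const hbound)

/-- A quasihyperbolic geodesic ray eventually leaves a neighbourhood of each point of `Ω`. -/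
theorem IsQHGeodesicOn.not_mapClusterPt {γ : ℝ → F} (hγ : IsQHGeodesicOn Ω γ (Ici 0))
    (hΩ : IsOpen Ω) (hz : z ∈ Ω) : ¬ MapClusterPt z atTop γ := by
  intro hcl
  obtain ⟨ε, hε, hball⟩ := Metric.isOpen_iff.1 hΩ z hz
  have hfreq : ∃ᶠ t in atTop, γ t ∈ ball z (ε / 2) :=
    hcl.frequently (ball_mem_nhds z (half_pos hε))
  obtain ⟨s, hs, hsz⟩ := frequently_atTop.1 hfreq 0
  obtain ⟨t, ht, htz⟩ := frequently_atTop.1 hfreq (s + 3)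
  have h := qhDist_le_two_of_mem_ball (half_pos hε)
    (by rwa [mul_div_cancel₀ _ two_ne_zero] : _ ⊆ Ω) htz hsz
  rw [hγ.2 t (mem_Ici.2 (by linarith)) s hs] at h
  linarith [le_abs_self (t - s)]

theorem IsQHGeodesicOn.eventually_notMem_of_isCompact {γ : ℝ → F} {K : Set F}
    (hγ : IsQHGeodesicOn Ω γ (Ici 0)) (hΩ : IsOpen Ω) (hK : IsCompact K) (hKΩ : K ⊆ Ω) :
    ∀ᶠ t in atTop, γ t ∉ K := by
  by_contra h
  obtain ⟨z, hz, hcl⟩ := hK.exists_mapClusterPt_of_frequently h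
  exact hγ.not_mapClusterPt hΩ (hKΩ hz) hcl

/-- The norm of a difference grows at most at the speed of the path. -/
theorem abs_deriv_norm_sub_le {γ : ℝ → F} {t f' : ℝ} (hγ : DifferentiableAt ℝ γ t)
    (hf : HasDerivAt (fun s => ‖γ s - x‖) f' t) : |f'| ≤ ‖deriv γ t‖ := by
  refine le_of_tendsto_of_tendsto (hasDerivAt_iff_tendsto_slope.1 hf).abs
    (hasDerivAt_iff_tendsto_slope.1 hγ.hasDerivAt).norm (Eventually.of_forall fun s => ?_)
  simp only [slope, vsub_eq_sub, norm_smul, smul_eq_mul, abs_mul, Real.norm_eq_abs]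
  gcongr
  simpa using abs_norm_sub_norm_le (γ s - x) (γ t - x)

theorem abs_log_sub_log_le {d u v : ℝ} (hd : 0 < d) (hu : d ≤ u) (hv : d ≤ v) :
    |Real.log u - Real.log v| ≤ d⁻¹ * |u - v| := by
  wlog huv : v ≤ u generalizing u v
  · rw [abs_sub_comm, abs_sub_comm u]
    exact this hv hu (le_of_not_ge huv)
  have hv0 : 0 < v := hd.trans_le hv
  have hu0 : 0 < u := hd.trans_le hu
  rw [abs_of_nonneg (sub_nonneg.2 (Real.log_le_log hv0 huv)), abs_of_nonneg (sub_nonneg.2 huv),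
    ← Real.log_div hu0.ne' hv0.ne']
  calc Real.log (u / v) ≤ u / v - 1 := Real.log_le_sub_one_of_pos (div_pos hu0 hv0)
    _ = v⁻¹ * (u - v) := by field_simp
    _ ≤ d⁻¹ * (u - v) := by
      have := sub_nonneg.2 huv
      gcongr

variable [FiniteDimensional ℝ F]

theorem qhAdmissible.intervalIntegrable {γ : ℝ → F} {a b : ℝ} (h : qhAdmissible Ω x y γ a b)
    (hΩ : IsOpen Ω) (hne : Ωᶜ.Nonempty) :
    IntervalIntegrable (fun t => ‖deriv γ t‖ / infDist (γ t) Ωᶜ) volume a b := by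
  obtain ⟨hab, -, -, hmem, K, hK⟩ := h
  have : CompleteSpace F := FiniteDimensional.complete ℝ F
  borelize F
  rw [intervalIntegrable_iff_integrableOn_Ioo_of_le hab]
  have hcont : ContinuousOn (fun t => (infDist (γ t) Ωᶜ)⁻¹) (Icc a b) :=
    ((continuous_infDist_pt _).comp_continuousOn hK.continuousOn).inv₀ fun t ht =>
      ((hΩ.isClosed_compl.notMem_iff_infDist_pos hne).1 (notMem_compl_iff.2 (hmem t ht))).ne'
  have hint : IntegrableOn (fun t => (infDist (γ t) Ωᶜ)⁻¹) (Ioo a b) :=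
    (hcont.integrableOn_Icc).mono_set Ioo_subset_Icc_self
  refine hint.bdd_mul (c := K) (measurable_deriv γ).norm.aestronglyMeasurable ?_
  filter_upwards [ae_restrict_mem measurableSet_Ioo] with t ht
  rw [norm_norm]
  exact norm_deriv_le_of_lipschitzOn (Icc_mem_nhds ht.1 ht.2) hK

/-- The standard lower bound for the quasihyperbolic length of a path. -/
theorem qhAdmissible.log_le_qhLength {γ : ℝ → F} {a b : ℝ} (h : qhAdmissible Ω x y γ a b)
    (hΩ : IsOpen Ω) (hne : Ωᶜ.Nonempty) :
    Real.log (infDist x Ωᶜ + ‖y - x‖) - Real.log (infDist x Ωᶜ) ≤ qhLength Ω γ a b := by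
  have hint := h.intervalIntegrable hΩ hne
  obtain ⟨hab, ha, hb, hmem, K, hK⟩ := h
  set d := infDist x Ωᶜ with hd_def
  have hpos : ∀ w ∈ Ω, 0 < infDist w Ωᶜ := fun w hw =>
    (hΩ.isClosed_compl.notMem_iff_infDist_pos hne).1 (notMem_compl_iff.2 hw)
  have hd : 0 < d := hpos x (ha ▸ hmem a ⟨le_rfl, hab⟩)
  set g : ℝ → ℝ := fun t => Real.log (d + ‖γ t - x‖) with hg_def
  have hdle : ∀ t, d ≤ d + ‖γ t - x‖ := fun t => le_add_of_nonneg_right (norm_nonneg _)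
  have hgLip : LipschitzOnWith (d.toNNReal⁻¹ * K) g (uIcc a b) := by
    rw [uIcc_of_le hab]
    refine LipschitzOnWith.of_dist_le_mul fun s hs t ht => ?_
    push_cast
    rw [Real.coe_toNNReal _ hd.le, mul_assoc, Real.dist_eq]
    refine (abs_log_sub_log_le hd (hdle s) (hdle t)).trans ?_
    gcongr
    refine le_trans ?_ (hK.dist_le_mul s hs t ht)
    rw [dist_eq_norm]
    simpa using abs_norm_sub_norm_le (γ s - x) (γ t - x)
  have hgAC := hgLip.absolutelyContinuousOnInterval
  have hval : g b - g a = Real.log (d + ‖y - x‖) - Real.log d := by simp [hg_def, ha, hb]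
  rw [← hval, ← hgAC.integral_deriv_eq_sub]
  refine intervalIntegral.integral_mono_ae_restrict hab hgAC.intervalIntegrable_deriv hint ?_
  have hdiff := hK.locallyBoundedVariationOn.ae_differentiableWithinAt_of_mem
  rw [← Measure.restrict_congr_set Ioo_ae_eq_Icc]
  filter_upwards [ae_restrict_mem measurableSet_Ioo, ae_restrict_of_ae hdiff] with t ht hdt
  have hγt : DifferentiableAt ℝ γ t :=
    (hdt (Ioo_subset_Icc_self ht)).differentiableAt (Icc_mem_nhds ht.1 ht.2)
  have hδ : 0 < infDist (γ t) Ωᶜ := hpos _ (hmem t (Ioo_subset_Icc_self ht))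
  by_cases hgt : DifferentiableAt ℝ g t
  · have hexp : ∀ s, Real.exp (g s) = d + ‖γ s - x‖ := fun s =>
      Real.exp_log (hd.trans_le (hdle s))
    have hf : HasDerivAt (fun s => ‖γ s - x‖) (Real.exp (g t) * deriv g t) t := by
      have := hgt.hasDerivAt.exp.sub_const d
      simpa [hexp] using this
    have hle := (le_abs_self _).trans (abs_deriv_norm_sub_le hγt hf)
    have hδle : infDist (γ t) Ωᶜ ≤ d + ‖γ t - x‖ := by
      simpa [dist_eq_norm] using infDist_le_infDist_add_dist (s := Ωᶜ) (x := γ t) (y := x)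
    rw [hexp] at hle
    calc deriv g t ≤ ‖deriv γ t‖ / (d + ‖γ t - x‖) := by
          rwa [le_div_iff₀ (hd.trans_le (hdle t)), mul_comm]
      _ ≤ ‖deriv γ t‖ / infDist (γ t) Ωᶜ := by gcongr
  · rw [deriv_zero_of_not_differentiableAt hgt]
    exact div_nonneg (norm_nonneg _) hδ.le

/-- Points at bounded quasihyperbolic distance are at Euclidean distance comparable to the
distance from the boundary. -/
theorem norm_sub_le_of_qhDist_lt {C : ℝ} (hΩ : IsOpen Ω) (hne : Ωᶜ.Nonempty) (hx : x ∈ Ω)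
    (hxy : ∃ γ a b, qhAdmissible Ω x y γ a b) (hC : qhDist Ω x y < C) :
    ‖y - x‖ ≤ infDist x Ωᶜ * Real.exp C := by
  obtain ⟨γ, a, b, hγ, hlt⟩ := exists_qhAdmissible_qhLength_lt hxy hC
  have hd : 0 < infDist x Ωᶜ :=
    (hΩ.isClosed_compl.notMem_iff_infDist_pos hne).1 (notMem_compl_iff.2 hx)
  have hlog := (hγ.log_le_qhLength hΩ hne).trans hlt.le
  have h : Real.log (infDist x Ωᶜ + ‖y - x‖) ≤ Real.log (infDist x Ωᶜ) + C := by linarith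
  rw [Real.log_le_iff_le_exp (by positivity), Real.exp_add, Real.exp_log hd] at h
  linarith

end Paths

/-- A geodesic piece of a ray, reparametrised to start at time `0`. -/
theorem IsQHGeodesicOn.comp_add {F : Type*} [NormedAddCommGroup F] [NormedSpace ℝ F] {Ω : Set F}
    {γ : ℝ → F} (hγ : IsQHGeodesicOn Ω γ (Ici 0)) {s : ℝ} (hs : 0 ≤ s) (T : ℝ) :
    IsQHGeodesicOn Ω (fun t => γ (s + t)) (Icc 0 T) := by
  refine ⟨fun t ht => hγ.1 _ (add_nonneg hs ht.1), fun a ha b hb => ?_⟩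
  rw [hγ.2 _ (add_nonneg hs ha.1) _ (add_nonneg hs hb.1), add_sub_add_left_eq_sub]

theorem IsQHGeodesicOn.exists_tendsto_frontier {F : Type*} [NormedAddCommGroup F]
    [NormedSpace ℝ F] [FiniteDimensional ℝ F] {Ω : Set F} (hΩ : IsOpen Ω)
    (hbdd : Bornology.IsBounded Ω) (hvis : QHVisibilityDomain Ω) {γ : ℝ → F}
    (hγ : IsQHGeodesicOn Ω γ (Ici 0)) : ∃ p ∈ frontier Ω, Tendsto γ atTop (𝓝 p) := by
  have : ProperSpace F := FiniteDimensional.proper ℝ F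
  have hcpt : IsCompact (closure Ω) := hbdd.isCompact_closure
  have hmem : ∀ᶠ t in atTop, γ t ∈ closure Ω :=
    (eventually_ge_atTop 0).mono fun t ht => subset_closure (hγ.1 t ht)
  have hfront : ∀ q ∈ closure Ω, MapClusterPt q atTop γ → q ∈ frontier Ω := fun q hq hcl => by
    rw [hΩ.frontier_eq]
    exact ⟨hq, fun h => hγ.not_mapClusterPt hΩ h hcl⟩
  obtain ⟨p, hp, hpcl⟩ := hcpt.exists_mapClusterPt_of_frequently hmem.frequently
  refine ⟨p, hfront p hp hpcl,
    hcpt.tendsto_nhds_of_unique_mapClusterPt hmem fun q hq hqcl => ?_⟩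
  by_contra hqp
  obtain ⟨U, V, hU, hV, hpU, hqV, -, K, hK, hKΩ, hmeet⟩ :=
    hvis p (hfront p hp hpcl) q (hfront q hq hqcl) (Ne.symm hqp)
  obtain ⟨R, hR⟩ := eventually_atTop.1 (hγ.eventually_notMem_of_isCompact hΩ hK hKΩ)
  obtain ⟨s, hs, hsU⟩ := frequently_atTop.1
    (hpcl.frequently (p := (· ∈ U)) (hU.mem_nhds hpU)) (max R 0)
  obtain ⟨t, ht, htV⟩ := frequently_atTop.1
    (hqcl.frequently (p := (· ∈ V)) (hV.mem_nhds hqV)) s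
  obtain ⟨u, hu, huK⟩ := hmeet (fun u => γ (s + u)) (t - s) (sub_nonneg.2 ht)
    (hγ.comp_add ((le_max_right _ _).trans hs) _) (by rwa [add_zero]) (by rwa [add_sub_cancel])
  exact hR (s + u) (by linarith [(le_max_left R 0).trans hs, hu.1]) huK

/-- Rays from a common point staying at bounded quasihyperbolic distance have the same landing
point, provided that one of them lands on the frontier. -/
theorem IsQHGeodesicOn.eq_of_tendsto {F : Type*} [NormedAddCommGroup F]
    [NormedSpace ℝ F] [FiniteDimensional ℝ F] {Ω : Set F} (hΩ : IsOpen Ω) {γ σ : ℝ → F}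
    (hγ : IsQHGeodesicOn Ω γ (Ici 0)) (hσ : IsQHGeodesicOn Ω σ (Ici 0)) (h₀ : γ 0 = σ 0) {M : ℝ}
    (hM : ∀ t, 0 ≤ t → qhDist Ω (γ t) (σ t) ≤ M) {p q : F} (hp : p ∈ frontier Ω)
    (hγp : Tendsto γ atTop (𝓝 p)) (hσq : Tendsto σ atTop (𝓝 q)) : p = q := by
  have hpc : p ∈ Ωᶜ := (hΩ.frontier_eq ▸ hp).2
  have hpath : ∀ {τ : ℝ → F}, IsQHGeodesicOn Ω τ (Ici 0) → ∀ t, 0 < t →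
      ∃ α a b, qhAdmissible Ω (τ 0) (τ t) α a b := fun hτ t ht =>
    exists_qhAdmissible_of_qhDist_ne_zero (by
      rw [hτ.2 0 self_mem_Ici t ht.le]; simpa using ht.ne')
  have hle : ∀ᶠ t in atTop, ‖σ t - γ t‖ ≤ infDist (γ t) Ωᶜ * Real.exp (M + 1) := by
    filter_upwards [eventually_gt_atTop 0] with t ht
    obtain ⟨α, a, b, hα⟩ := hpath hγ t ht
    obtain ⟨β, c, d, hβ⟩ := hpath hσ t ht
    rw [← h₀] at hβ
    exact norm_sub_le_of_qhDist_lt hΩ ⟨p, hpc⟩ (hγ.1 t ht.le) ⟨_, _, _, hα.symm.trans hβ⟩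
      ((hM t ht.le).trans_lt (lt_add_one M))
  have hlim : Tendsto (fun t => infDist (γ t) Ωᶜ * Real.exp (M + 1)) atTop (𝓝 0) := by
    have := (((continuous_infDist_pt Ωᶜ).tendsto p).comp hγp).mul_const (Real.exp (M + 1))
    simpa [infDist_zero_of_mem hpc] using this
  have h := le_of_tendsto_of_tendsto (hσq.sub hγp).norm hlim hle
  exact (sub_eq_zero.1 (norm_le_zero_iff.1 h)).symm

/-- In a bounded QH-visibility domain `Ω ⊆ ℝⁿ`, every quasihyperbolic
geodesic ray lands at a point of the Euclidean boundary, and two equivalent geodesic rays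
issuing from the same point land at the same boundary point. -/
theorem statement18 {n : ℕ} (Ω : Set (EuclideanSpace ℝ (Fin n)))
    (hOpen : IsOpen Ω) (hConn : IsConnected Ω) (hBdd : Bornology.IsBounded Ω)
    (hVis : QHVisibilityDomain Ω) :
    (∀ γ : ℝ → EuclideanSpace ℝ (Fin n), IsQHGeodesicOn Ω γ (Ici 0) →
      ∃ p ∈ frontier Ω, Tendsto γ atTop (𝓝 p)) ∧
    (∀ (γ σ : ℝ → EuclideanSpace ℝ (Fin n)) (x₀ : EuclideanSpace ℝ (Fin n)), x₀ ∈ Ω →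
      IsQHGeodesicOn Ω γ (Ici 0) → IsQHGeodesicOn Ω σ (Ici 0) →
      γ 0 = x₀ → σ 0 = x₀ →
      (∃ M : ℝ, ∀ t : ℝ, 0 ≤ t → qhDist Ω (γ t) (σ t) ≤ M) →
      ∀ p q : EuclideanSpace ℝ (Fin n),
        Tendsto γ atTop (𝓝 p) → Tendsto σ atTop (𝓝 q) → p = q) := by
  refine ⟨fun γ hγ => hγ.exists_tendsto_frontier hOpen hBdd hVis, ?_⟩
  rintro γ σ x₀ - hγ hσ hγ₀ hσ₀ ⟨M, hM⟩ p q hp hq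
  obtain ⟨p', hp', hlim⟩ := hγ.exists_tendsto_frontier hOpen hBdd hVis
  obtain rfl := tendsto_nhds_unique hp hlim
  exact hγ.eq_of_tendsto hOpen hσ (hγ₀.trans hσ₀.symm) hM hp' hp hq

end
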